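/- arXiv:math/0609413 — 5 statements merged into one kernel-verified Lean document; each statement's English description precedes it below -/
import Mathlib

section
/- For every composition (s_1, …, s_r) of positive integers with s_1 ≥ 2, the multiple series ∑_{n_1 > n_2 > … > n_r ≥ 1} 1/(n_1^{s_1} n_2^{s_2} ⋯ n_r^{s_r}) (the sum ranging over all strictly decreasing r-tuples of positive integers) is summable, i.e. the multiple zeta value ζ(s_1, …, s_r) is a well-defined real number. -/
/-- The index set for the multiple zeta series attached to a composition `s`:
strictly decreasing tuples `n₁ > n₂ > ⋯ > n_r ≥ 1` of positive integers,
encoded as lists of the same length as `s`. -/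
def MzvIndex (s : List ℕ) : Type :=
  {n : List ℕ // n.length = s.length ∧ n.Chain' (· > ·) ∧ ∀ x ∈ n, 0 < x}

/-- The term `1/(n₁^{s₁} ⋯ n_r^{s_r})` of the multiple zeta series. -/
noncomputable def mzvTerm (s : List ℕ) (n : MzvIndex s) : ℝ :=
  ((s.zip n.1).map fun p => (1 : ℝ) / (p.2 : ℝ) ^ p.1).prod

/-- If `f` is nonnegative and summable, so is the product of its values over tuples of fixed
length. -/
theorem summable_list_prod_of_nonneg {α : Type*} {f : α → ℝ} (hf0 : ∀ a, 0 ≤ f a)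
    (hf : Summable f) (r : ℕ) :
    Summable fun v : {l : List α // l.length = r} => (v.1.map f).prod := by
  induction r with
  | zero =>
    have : Subsingleton {l : List α // l.length = 0} :=
      ⟨fun a b => Subtype.ext ((List.length_eq_zero_iff.1 a.2).trans
        (List.length_eq_zero_iff.1 b.2).symm)⟩
    exact Summable.of_finite
  | succ r ih =>
    have hmul := hf.mul_of_nonneg ih hf0 fun v =>
      List.prod_nonneg fun x hx => by
        obtain ⟨a, -, rfl⟩ := List.mem_map.1 hx
        exact hf0 a
    let e : {l : List α // l.length = r + 1} → α × {l : List α // l.length = r} := fun v =>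
      (v.1.head (List.ne_nil_of_length_eq_add_one v.2), ⟨v.1.tail, by simp [v.2]⟩)
    have he : Function.Injective e := by
      rintro ⟨_ | ⟨a, l⟩, hl⟩ ⟨_ | ⟨b, m⟩, hm⟩ h
      · rfl
      · simp at hl
      · simp at hm
      · simpa [e] using h
    refine (hmul.comp_injective he).congr ?_
    rintro ⟨_ | ⟨a, l⟩, hl⟩
    · simp at hl
    · simp [e]

/-- Lowering exponents by `ε` in a product of inverse powers of integers at most `N` costs at most
a factor `N ^ ε` for each of them. -/
theorem list_prod_one_div_pow_le {ε : ℝ} (hε : 0 ≤ ε) (N : ℕ) (t m : List ℕ)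
    (hlen : m.length = t.length) (ht : ∀ x ∈ t, 0 < x) (hm : ∀ x ∈ m, 0 < x ∧ x ≤ N) :
    ((t.zip m).map fun p => (1 : ℝ) / (p.2 : ℝ) ^ p.1).prod ≤
      (N : ℝ) ^ (ε * m.length) * (m.map fun x : ℕ => (x : ℝ) ^ (-(1 + ε))).prod := by
  induction t generalizing m with
  | nil => simp_all
  | cons k t ih =>
    cases m with
    | nil => simp at hlen
    | cons x m =>
      simp only [List.mem_cons, forall_eq_or_imp] at ht hm
      obtain ⟨⟨hx, hxN⟩, hm⟩ := hm
      have hx0 : (0 : ℝ) < x := by exact_mod_cast hx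
      have hx1 : (1 : ℝ) ≤ x := by exact_mod_cast hx
      have hxN' : (x : ℝ) ≤ N := by exact_mod_cast hxN
      have hN0 : (0 : ℝ) < N := hx0.trans_le hxN'
      have h1 : (1 : ℝ) / (x : ℝ) ^ k ≤ (N : ℝ) ^ ε * (x : ℝ) ^ (-(1 + ε)) := by
        calc (1 : ℝ) / (x : ℝ) ^ k ≤ 1 / (x : ℝ) :=
              one_div_le_one_div_of_le hx0 (le_self_pow₀ hx1 ht.1.ne')
          _ = (x : ℝ) ^ ε * (x : ℝ) ^ (-(1 + ε)) := by
              rw [← Real.rpow_add hx0, show ε + -(1 + ε) = -1 by ring, Real.rpow_neg_one, one_div]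
          _ ≤ (N : ℝ) ^ ε * (x : ℝ) ^ (-(1 + ε)) := by gcongr
      have h2 := ih m (by simpa using hlen) ht.2 hm
      simp only [List.zip_cons_cons, List.map_cons, List.prod_cons, List.length_cons]
      have h3 : (N : ℝ) ^ (ε * ((m.length + 1 : ℕ) : ℝ)) =
          (N : ℝ) ^ ε * (N : ℝ) ^ (ε * (m.length : ℝ)) := by
        rw [← Real.rpow_add hN0]
        congr 1
        push_cast
        ring
      rw [h3]
      refine (mul_le_mul h1 h2 (List.prod_nonneg fun y hy => ?_) (by positivity)).trans_eq (by ring)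
      obtain ⟨p, -, rfl⟩ := List.mem_map.1 hy
      positivity

/-- The terms of a multiple zeta series are dominated by products of summable powers. -/
theorem mzvTerm_le (s : List ℕ) (hne : s ≠ []) (hpos : ∀ x ∈ s, 0 < x) (hhead : 2 ≤ s.headI)
    (n : MzvIndex s) :
    mzvTerm s n ≤ (n.1.map fun x : ℕ => (x : ℝ) ^ (-(1 + (s.length : ℝ)⁻¹))).prod := by
  obtain ⟨m, hlen, hchain, hm⟩ := n
  cases s with
  | nil => exact absurd rfl hne
  | cons k t =>
    cases m with
    | nil => simp at hlen
    | cons N m =>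
      simp only [List.mem_cons, forall_eq_or_imp] at hpos hm
      have hlt : ∀ x ∈ m, x < N := (List.pairwise_cons.1 (List.isChain_iff_pairwise.1 hchain)).1
      have hlen' : m.length = t.length := by simpa using hlen
      have hN0 : (0 : ℝ) < N := by exact_mod_cast hm.1
      have hN1 : (1 : ℝ) ≤ N := by exact_mod_cast hm.1
      set ε : ℝ := ((k :: t).length : ℝ)⁻¹ with hε
      have hε0 : 0 ≤ ε := by positivity
      have hεr : ε * (m.length + 1) = 1 := by
        rw [hε, hlen', List.length_cons]
        push_cast
        exact inv_mul_cancel₀ (by positivity)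
      have h1 : (1 : ℝ) / (N : ℝ) ^ k ≤ (N : ℝ) ^ (-2 : ℝ) := by
        rw [Real.rpow_neg hN0.le, Real.rpow_two, ← one_div]
        exact one_div_le_one_div_of_le (by positivity) (pow_le_pow_right₀ hN1 hhead)
      have h2 := list_prod_one_div_pow_le hε0 N t m hlen' hpos.2
        fun x hx => ⟨hm.2 x hx, (hlt x hx).le⟩
      have h3 : (N : ℝ) ^ (-2 : ℝ) * (N : ℝ) ^ (ε * m.length) = (N : ℝ) ^ (-(1 + ε)) := by
        rw [← Real.rpow_add hN0]
        congr 1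
        linarith
      simp only [mzvTerm, List.zip_cons_cons, List.map_cons, List.prod_cons]
      rw [← h3, mul_assoc]
      refine mul_le_mul h1 h2 (List.prod_nonneg fun y hy => ?_) (by positivity)
      obtain ⟨p, -, rfl⟩ := List.mem_map.1 hy
      positivity

/-- For every composition `(s₁, …, s_r)` of positive integers with `s₁ ≥ 2`, the
multiple series `∑_{n₁ > n₂ > ⋯ > n_r ≥ 1} 1/(n₁^{s₁} ⋯ n_r^{s_r})` is summable. -/
theorem mzv_summable_of_two_le_head (s : List ℕ) (hne : s ≠ [])
    (hpos : ∀ x ∈ s, 0 < x) (hhead : 2 ≤ s.headI) :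
    Summable (mzvTerm s) := by
  have hr : (0 : ℝ) < (s.length : ℝ)⁻¹ :=
    inv_pos.2 (by exact_mod_cast List.length_pos_iff.2 hne)
  have hsum : Summable fun x : ℕ => (x : ℝ) ^ (-(1 + (s.length : ℝ)⁻¹)) :=
    Real.summable_nat_rpow.2 (by linarith)
  let e : MzvIndex s → {l : List ℕ // l.length = s.length} := fun n => ⟨n.1, n.2.1⟩
  have he : Function.Injective e := fun a b h => Subtype.ext (Subtype.mk.inj h)
  refine Summable.of_nonneg_of_le (fun n => List.prod_nonneg fun y hy => ?_)
    (mzvTerm_le s hne hpos hhead)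
    ((summable_list_prod_of_nonneg (fun x : ℕ => by positivity) hsum s.length).comp_injective he)
  obtain ⟨p, -, rfl⟩ := List.mem_map.1 hy
  positivity
end

section
/- For all integers a ≥ 2 and b ≥ 2, the product of single zeta values satisfies the harmonic (stuffle) product formula: ζ(a)·ζ(b) = ζ(a, b) + ζ(b, a) + ζ(a + b). -/
/-- The multiple zeta value `ζ(s₁, …, s_r)`. -/
noncomputable def mzv (s : List ℕ) : ℝ := ∑' n : MzvIndex s, mzvTerm s n

/-- The index set of a double zeta series is the set of pairs `n₁ > n₂` of positive integers. -/
def mzvIndexPairEquiv (a b : ℕ) : {p : ℕ+ × ℕ+ | p.2 < p.1} ≃ MzvIndex [a, b] where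
  toFun p := ⟨[(p.1.1 : ℕ), (p.1.2 : ℕ)], rfl, List.isChain_pair.mpr p.2, by simp⟩
  invFun n := ⟨(⟨n.1[0]'(by rw [n.2.1]; simp), n.2.2.2 _ (List.getElem_mem _)⟩,
      ⟨n.1[1]'(by rw [n.2.1]; simp), n.2.2.2 _ (List.getElem_mem _)⟩), by
    obtain ⟨l, hl, hc, hp⟩ := n
    obtain ⟨x, y, rfl⟩ := List.length_eq_two.mp hl
    exact (List.isChain_pair.mp hc : x > y)⟩
  left_inv p := rfl
  right_inv n := by
    obtain ⟨l, hl, hc, hp⟩ := n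
    obtain ⟨x, y, rfl⟩ := List.length_eq_two.mp hl
    rfl

/-- The index set of a single zeta series is the set of positive integers. -/
def mzvIndexSingleEquiv (a : ℕ) : ℕ+ ≃ MzvIndex [a] where
  toFun n := ⟨[(n : ℕ)], rfl, List.isChain_singleton _, by simp⟩
  invFun n := ⟨n.1[0]'(by rw [n.2.1]; simp), n.2.2.2 _ (List.getElem_mem _)⟩
  left_inv n := rfl
  right_inv n := by
    obtain ⟨l, hl, hc, hp⟩ := n
    obtain ⟨x, rfl⟩ := List.length_eq_one_iff.mp hl
    rfl

theorem mzv_single (a : ℕ) : mzv [a] = ∑' n : ℕ+, 1 / (n : ℝ) ^ a := by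
  rw [mzv, ← (mzvIndexSingleEquiv a).tsum_eq]
  refine tsum_congr fun n => ?_
  simp [mzvTerm, show (mzvIndexSingleEquiv a n).1 = [(n : ℕ)] from rfl]

theorem mzv_pair (a b : ℕ) :
    mzv [a, b] = ∑' p : {p : ℕ+ × ℕ+ | p.2 < p.1},
      1 / (p.1.1 : ℝ) ^ a * (1 / (p.1.2 : ℝ) ^ b) := by
  rw [mzv, ← (mzvIndexPairEquiv a b).tsum_eq]
  refine tsum_congr fun p => ?_
  simp [mzvTerm, show (mzvIndexPairEquiv a b p).1 = [(p.1.1 : ℕ), (p.1.2 : ℕ)] from rfl]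

theorem summable_pnat_one_div_pow {a : ℕ} (ha : 2 ≤ a) :
    Summable fun n : ℕ+ => 1 / (n : ℝ) ^ a :=
  (Real.summable_one_div_nat_pow.mpr ha).comp_injective PNat.coe_injective

/-- A sum over pairs splits into the sums over the two strict triangles and the diagonal. -/
theorem Summable.tsum_prod_eq_lt_add_gt_add_diag {α : Type*} [LinearOrder α] {F : α × α → ℝ}
    (hF : Summable F) :
    ∑' p, F p = ∑' p : {p : α × α | p.2 < p.1}, F p +
      ∑' p : {p : α × α | p.2 < p.1}, F p.1.swap + ∑' x, F (x, x) := by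
  have hswap : ∑' p : {p : α × α | p.2 < p.1}, F p.1.swap =
      ∑' p : {p : α × α | p.1 < p.2}, F p :=
    ((Equiv.prodComm α α).subtypeEquiv fun _ => Iff.rfl).tsum_eq
      fun p : {p : α × α | p.1 < p.2} => F p
  have hdiag : ∑' x, F (x, x) = ∑' p : Set.diagonal α, F p := by
    rw [← Set.range_diag]
    exact (tsum_range F fun x y h => congrArg Prod.fst h).symm
  rw [hswap, hdiag, tsum_subtype, tsum_subtype, tsum_subtype,
    ← (hF.indicator _).tsum_add (hF.indicator _),
    ← ((hF.indicator _).add (hF.indicator _)).tsum_add (hF.indicator _)]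
  refine tsum_congr fun ⟨x, y⟩ => ?_
  rcases lt_trichotomy x y with h | rfl | h
  · simp [Set.indicator, h, h.not_gt, h.ne]
  · simp [Set.indicator]
  · simp [Set.indicator, h, h.not_gt, h.ne']

/-- For integers `a, b ≥ 2`, the harmonic (stuffle) product formula
`ζ(a)·ζ(b) = ζ(a, b) + ζ(b, a) + ζ(a + b)` holds. -/
theorem zeta_mul_zeta (a b : ℕ) (ha : 2 ≤ a) (hb : 2 ≤ b) :
    mzv [a] * mzv [b] = mzv [a, b] + mzv [b, a] + mzv [a + b] := by
  have hsa := summable_pnat_one_div_pow ha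
  have hsb := summable_pnat_one_div_pow hb
  have hs : Summable fun p : ℕ+ × ℕ+ => 1 / (p.1 : ℝ) ^ a * (1 / (p.2 : ℝ) ^ b) :=
    hsa.mul_of_nonneg hsb (fun _ => by positivity) fun _ => by positivity
  rw [mzv_single a, mzv_single b, hsa.tsum_mul_tsum hsb hs,
    hs.tsum_prod_eq_lt_add_gt_add_diag, mzv_pair, mzv_pair, mzv_single]
  congr 1
  · congr 1
    exact tsum_congr fun _ => mul_comm _ _
  · refine tsum_congr fun n => ?_
    rw [pow_add, one_div_mul_one_div]
end

section
/- For any two admissible indices u and v, one has ζ(u)·ζ(v) = ∑_{w} m_w · ζ(w), where the sum (with multiplicities m_w ∈ ℕ) runs over the formal sum of compositions u ⋆ v given by the stuffle product; every composition occurring in u ⋆ v is again admissible, so all terms on the right are convergent multiple zeta values. In other words, the map sending an admissible index to its multiple zeta value is multiplicative with respect to the stuffle product. -/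
/-- An admissible index: a nonempty composition of positive integers whose
first entry is at least 2. -/
def Admissible (s : List ℕ) : Prop :=
  s ≠ [] ∧ (∀ x ∈ s, 0 < x) ∧ 2 ≤ s.headI

/-- The stuffle (harmonic, quasi-shuffle) product of two compositions, as a
formal ℕ-linear combination (multiset) of compositions. -/
def stuffle : List ℕ → List ℕ → Multiset (List ℕ)
  | [], v => {v}
  | a :: u, [] => {a :: u}
  | a :: u, b :: v =>
      (stuffle u (b :: v)).map (a :: ·) +
      (stuffle (a :: u) v).map (b :: ·) +
      (stuffle u v).map ((a + b) :: ·)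
  termination_by u v => u.length + v.length

/-- The truncated multiple zeta value: the sum over `N ≥ n₁ > ⋯ > n_r ≥ 1`. -/
noncomputable def truncatedMzv : List ℕ → ℕ → ℝ
  | [], _ => 1
  | a :: s, N => ∑ n ∈ Finset.range N, 1 / ((n + 1 : ℕ) : ℝ) ^ a * truncatedMzv s n

/-- The strictly decreasing tuples of positive integers at most `N`, of the same length as `s`. -/
def truncatedIndex : List ℕ → ℕ → Finset (List ℕ)
  | [], _ => {[]}
  | _ :: s, N => (Finset.range N).biUnion fun n => (truncatedIndex s n).image ((n + 1) :: ·)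

theorem sum_range_mul_sum_range (f g : ℕ → ℝ) (N : ℕ) :
    (∑ n ∈ Finset.range N, f n) * (∑ n ∈ Finset.range N, g n) =
      ∑ n ∈ Finset.range N, f n * (∑ m ∈ Finset.range n, g m) +
      ∑ n ∈ Finset.range N, g n * (∑ m ∈ Finset.range n, f m) +
      ∑ n ∈ Finset.range N, f n * g n := by
  induction N with
  | zero => simp
  | succ N ih =>
    simp only [Finset.sum_range_succ]
    linear_combination ih

theorem sum_map_truncatedMzv_cons (S : Multiset (List ℕ)) (a N : ℕ) :
    (S.map fun w => truncatedMzv (a :: w) N).sum =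
      ∑ n ∈ Finset.range N,
        1 / ((n + 1 : ℕ) : ℝ) ^ a * (S.map fun w => truncatedMzv w n).sum := by
  induction S using Multiset.induction_on with
  | empty => simp
  | cons w S ih =>
    simp only [Multiset.map_cons, Multiset.sum_cons, ih, mul_add, Finset.sum_add_distrib]
    rfl

theorem truncatedMzv_mul (u v : List ℕ) (N : ℕ) :
    truncatedMzv u N * truncatedMzv v N =
      ((stuffle u v).map fun w => truncatedMzv w N).sum := by
  induction u, v using stuffle.induct generalizing N with
  | case1 v => simp [stuffle, truncatedMzv]
  | case2 a u => simp [stuffle, truncatedMzv]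
  | case3 a u b v ih₁ ih₂ ih₃ =>
    rw [stuffle]
    simp only [Multiset.map_add, Multiset.sum_add, Multiset.map_map, Function.comp_def,
      sum_map_truncatedMzv_cons, ← ih₁, ← ih₂, ← ih₃]
    simp only [truncatedMzv]
    rw [sum_range_mul_sum_range]
    congr 1
    · congr 1 <;> refine Finset.sum_congr rfl fun n _ => by ring
    · refine Finset.sum_congr rfl fun n _ => ?_
      rw [pow_add, ← one_div_mul_one_div]
      ring

theorem truncatedMzv_nonneg (s : List ℕ) (N : ℕ) : 0 ≤ truncatedMzv s N := by
  induction s generalizing N with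
  | nil => simp [truncatedMzv]
  | cons a s ih =>
    exact Finset.sum_nonneg fun n _ => mul_nonneg (by positivity) (ih n)

theorem sqrt_div_le_sqrt_sub_sqrt (x : ℝ) (hx : 1 ≤ x) :
    1 / x * √x ≤ 3 * (√(x + 1) - √x) := by
  have hx0 : 0 < √x := Real.sqrt_pos.2 (by linarith)
  have h1 := Real.sq_sqrt (show 0 ≤ x by linarith)
  have h2 := Real.sq_sqrt (show 0 ≤ x + 1 by linarith)
  have h3 : √(x + 1) ≤ 2 * √x := by
    rw [Real.sqrt_le_left (by positivity)]
    nlinarith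
  have h4 : 1 / x * √x = 1 / √x := by
    field_simp
    exact h1
  rw [h4, div_le_iff₀ hx0]
  nlinarith [Real.sqrt_nonneg (x + 1), Real.sqrt_le_sqrt (show x ≤ x + 1 by linarith)]

theorem truncatedMzv_le_sqrt (s : List ℕ) (hs : ∀ x ∈ s, 0 < x) (N : ℕ) :
    truncatedMzv s N ≤ 3 ^ s.length * √((N + 1 : ℕ) : ℝ) := by
  induction s generalizing N with
  | nil => simp [truncatedMzv]
  | cons a s ih =>
    simp only [List.mem_cons, forall_eq_or_imp] at hs
    have key : ∀ n ∈ Finset.range N, 1 / ((n + 1 : ℕ) : ℝ) ^ a * truncatedMzv s n ≤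
        3 ^ (s.length + 1) * (√((n + 1 + 1 : ℕ) : ℝ) - √((n + 1 : ℕ) : ℝ)) := by
      intro n _
      have h1 : (1 : ℝ) ≤ ((n + 1 : ℕ) : ℝ) := by exact_mod_cast Nat.succ_pos n
      have h2 : 1 / ((n + 1 : ℕ) : ℝ) ^ a ≤ 1 / ((n + 1 : ℕ) : ℝ) :=
        one_div_le_one_div_of_le (by positivity) (le_self_pow₀ h1 hs.1.ne')
      calc _ ≤ 1 / ((n + 1 : ℕ) : ℝ) * (3 ^ s.length * √((n + 1 : ℕ) : ℝ)) :=
            mul_le_mul h2 (ih hs.2 n) (truncatedMzv_nonneg _ _) (by positivity)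
        _ = 3 ^ s.length * (1 / ((n + 1 : ℕ) : ℝ) * √((n + 1 : ℕ) : ℝ)) := by ring
        _ ≤ 3 ^ s.length * (3 * (√(((n + 1 : ℕ) : ℝ) + 1) - √((n + 1 : ℕ) : ℝ))) := by
            exact mul_le_mul_of_nonneg_left (sqrt_div_le_sqrt_sub_sqrt _ h1) (by positivity)
        _ = _ := by push_cast; ring
    refine (Finset.sum_le_sum key).trans ?_
    rw [← Finset.mul_sum, Finset.sum_range_sub (fun n : ℕ => √((n + 1 : ℕ) : ℝ))]
    simp only [List.length_cons]
    gcongr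
    simp

theorem exists_truncatedMzv_le (s : List ℕ) (hs : Admissible s) :
    ∃ C, ∀ N, truncatedMzv s N ≤ C := by
  obtain ⟨hne, hpos, hhead⟩ := hs
  cases s with
  | nil => exact absurd rfl hne
  | cons a s =>
    simp only [List.mem_cons, forall_eq_or_imp, List.headI_cons] at hpos hhead
    have hsum : Summable fun n : ℕ =>
        (3 : ℝ) ^ s.length * (1 / ((n + 1 : ℕ) : ℝ) ^ (3 / 2 : ℝ)) :=
      ((summable_nat_add_iff 1).2
        (Real.summable_one_div_nat_rpow.2 (show (1 : ℝ) < 3 / 2 by norm_num))).mul_left _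
    refine ⟨_, fun N => (Finset.sum_le_sum fun n _ => ?_).trans
      (hsum.sum_le_tsum (Finset.range N) fun n _ => by positivity)⟩
    have h1 : (1 : ℝ) ≤ ((n + 1 : ℕ) : ℝ) := by exact_mod_cast Nat.succ_pos n
    have h0 : (0 : ℝ) < ((n + 1 : ℕ) : ℝ) := by linarith
    have h2 : 1 / ((n + 1 : ℕ) : ℝ) ^ a ≤ 1 / ((n + 1 : ℕ) : ℝ) ^ 2 :=
      one_div_le_one_div_of_le (by positivity) (pow_le_pow_right₀ h1 hhead)
    refine (mul_le_mul h2 (truncatedMzv_le_sqrt s hpos.2 n) (truncatedMzv_nonneg _ _)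
      (by positivity)).trans_eq ?_
    have h3 : ((n + 1 : ℕ) : ℝ) ^ 2 =
        ((n + 1 : ℕ) : ℝ) ^ (3 / 2 : ℝ) * √((n + 1 : ℕ) : ℝ) := by
      rw [Real.sqrt_eq_rpow, ← Real.rpow_add h0, ← Real.rpow_natCast]
      norm_num
    have h4 : 0 < √((n + 1 : ℕ) : ℝ) := Real.sqrt_pos.2 h0
    rw [h3]
    field_simp

theorem mem_truncatedIndex (s l : List ℕ) (N : ℕ) :
    l ∈ truncatedIndex s N ↔
      (l.length = s.length ∧ l.IsChain (· > ·) ∧ ∀ x ∈ l, 0 < x) ∧ ∀ x ∈ l, x ≤ N := by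
  induction s generalizing l N with
  | nil =>
    simp only [truncatedIndex, Finset.mem_singleton, List.length_nil, List.length_eq_zero_iff]
    constructor
    · rintro rfl
      simp
    · exact fun h => h.1.1
  | cons a s ih =>
    simp only [truncatedIndex, Finset.mem_biUnion, Finset.mem_range, Finset.mem_image, ih]
    constructor
    · rintro ⟨n, hn, t, ⟨⟨hl, hc, hp⟩, hle⟩, rfl⟩
      refine ⟨⟨by simpa using hl, ?_, ?_⟩, ?_⟩
      · rw [List.isChain_iff_pairwise] at hc ⊢
        exact List.pairwise_cons.2 ⟨fun x hx => Nat.lt_succ_of_le (hle x hx), hc⟩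
      · simpa using hp
      · simp only [List.mem_cons, forall_eq_or_imp]
        exact ⟨hn, fun x hx => (hle x hx).trans hn.le⟩
    · rintro ⟨⟨hl, hc, hp⟩, hle⟩
      cases l with
      | nil => simp at hl
      | cons m t =>
        rw [List.isChain_iff_pairwise, List.pairwise_cons] at hc
        simp only [List.mem_cons, forall_eq_or_imp, List.length_cons, add_left_inj] at hl hp hle
        obtain ⟨k, rfl⟩ := Nat.exists_eq_succ_of_ne_zero hp.1.ne'
        exact ⟨k, hle.1, t, ⟨⟨hl, List.isChain_iff_pairwise.2 hc.2, hp.2⟩,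
          fun x hx => Nat.le_of_lt_succ (hc.1 x hx)⟩, rfl⟩

theorem sum_truncatedIndex (s : List ℕ) (N : ℕ) :
    ∑ l ∈ truncatedIndex s N, ((s.zip l).map fun p => (1 : ℝ) / (p.2 : ℝ) ^ p.1).prod =
      truncatedMzv s N := by
  induction s generalizing N with
  | nil => simp [truncatedIndex, truncatedMzv]
  | cons a s ih =>
    rw [truncatedIndex, Finset.sum_biUnion]
    · refine Finset.sum_congr rfl fun n _ => ?_
      rw [Finset.sum_image fun _ _ _ _ h => (List.cons.inj h).2, ← ih, Finset.mul_sum]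
      simp
    · intro i _ j _ hij
      simp only [Function.onFun, Finset.disjoint_left, Finset.mem_image]
      rintro _ ⟨t, _, rfl⟩ ⟨t', _, h⟩
      exact hij (Nat.succ_injective (List.cons.inj h).1).symm

/-- The elements of `MzvIndex s` all of whose entries are at most `N`. -/
noncomputable def boundedMzvIndex (s : List ℕ) (N : ℕ) : Finset (MzvIndex s) :=
  open Classical in (truncatedIndex s N).subtype _

theorem mem_boundedMzvIndex (s : List ℕ) (N : ℕ) (n : MzvIndex s) :
    n ∈ boundedMzvIndex s N ↔ ∀ x ∈ n.1, x ≤ N := by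
  classical
  refine Finset.mem_subtype.trans ((mem_truncatedIndex s n.1 N).trans ?_)
  exact ⟨fun h => h.2, fun h => ⟨n.2, h⟩⟩

theorem sum_boundedMzvIndex (s : List ℕ) (N : ℕ) :
    ∑ n ∈ boundedMzvIndex s N, mzvTerm s n = truncatedMzv s N := by
  rw [← sum_truncatedIndex]
  refine Finset.sum_nbij (fun n => n.1) (fun n hn => ?_) (fun _ _ _ _ h => Subtype.ext h)
    (fun l hl => ?_) fun _ _ => rfl
  · exact (mem_truncatedIndex s n.1 N).2 ⟨n.2, (mem_boundedMzvIndex s N n).1 hn⟩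
  · obtain ⟨h, hle⟩ := (mem_truncatedIndex s l N).1 hl
    exact ⟨⟨l, h⟩, (mem_boundedMzvIndex s N _).2 hle, rfl⟩

theorem tendsto_boundedMzvIndex (s : List ℕ) :
    Filter.Tendsto (boundedMzvIndex s) Filter.atTop Filter.atTop := by
  refine Filter.tendsto_atTop_finset_of_monotone (fun M N h n hn => ?_) fun n =>
    ⟨n.1.sum, (mem_boundedMzvIndex _ _ _).2 fun x hx => List.le_sum_of_mem hx⟩
  rw [mem_boundedMzvIndex] at hn ⊢
  exact fun x hx => (hn x hx).trans h

theorem mzvTerm_nonneg (s : List ℕ) (n : MzvIndex s) : 0 ≤ mzvTerm s n := by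
  refine List.prod_nonneg fun x hx => ?_
  obtain ⟨p, _, rfl⟩ := List.mem_map.1 hx
  positivity

theorem summable_mzvTerm (s : List ℕ) (hs : Admissible s) : Summable (mzvTerm s) := by
  obtain ⟨C, hC⟩ := exists_truncatedMzv_le s hs
  refine summable_of_sum_le (c := C) (mzvTerm_nonneg s) fun F => ?_
  obtain ⟨N, hN⟩ := ((tendsto_boundedMzvIndex s).eventually_ge_atTop F).exists
  calc ∑ n ∈ F, mzvTerm s n ≤ ∑ n ∈ boundedMzvIndex s N, mzvTerm s n :=
        Finset.sum_le_sum_of_subset_of_nonneg hN fun n _ _ => mzvTerm_nonneg s n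
    _ ≤ C := (sum_boundedMzvIndex s N).trans_le (hC N)

theorem tendsto_truncatedMzv (s : List ℕ) (hs : Admissible s) :
    Filter.Tendsto (truncatedMzv s) Filter.atTop (nhds (mzv s)) := by
  have h := (summable_mzvTerm s hs).hasSum.comp (tendsto_boundedMzvIndex s)
  exact h.congr fun N => sum_boundedMzvIndex s N

theorem pos_of_mem_stuffle (u v : List ℕ) (hu : ∀ x ∈ u, 0 < x) (hv : ∀ x ∈ v, 0 < x) :
    ∀ w ∈ stuffle u v, ∀ x ∈ w, 0 < x := by
  induction u, v using stuffle.induct with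
  | case1 v => simpa [stuffle] using hv
  | case2 a u => simpa [stuffle] using hu
  | case3 a u b v ih₁ ih₂ ih₃ =>
    have hu' := List.forall_mem_cons.1 hu
    have hv' := List.forall_mem_cons.1 hv
    intro w hw
    simp only [stuffle, Multiset.mem_add, Multiset.mem_map] at hw
    rcases hw with (⟨t, ht, rfl⟩ | ⟨t, ht, rfl⟩) | ⟨t, ht, rfl⟩
    · exact List.forall_mem_cons.2 ⟨hu'.1, ih₁ hu'.2 hv t ht⟩
    · exact List.forall_mem_cons.2 ⟨hv'.1, ih₂ hu hv'.2 t ht⟩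
    · exact List.forall_mem_cons.2 ⟨Nat.add_pos_left hu'.1 b, ih₃ hu'.2 hv'.2 t ht⟩

theorem admissible_of_mem_stuffle (u v : List ℕ) (hu : Admissible u) (hv : Admissible v) :
    ∀ w ∈ stuffle u v, Admissible w := by
  intro w hw
  have hpos := pos_of_mem_stuffle u v hu.2.1 hv.2.1 w hw
  obtain ⟨hune, -, hu2⟩ := hu
  obtain ⟨hvne, -, hv2⟩ := hv
  cases u with
  | nil => exact absurd rfl hune
  | cons a u =>
  cases v with
  | nil => exact absurd rfl hvne
  | cons b v =>
  simp only [List.headI_cons] at hu2 hv2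
  simp only [stuffle, Multiset.mem_add, Multiset.mem_map] at hw
  rcases hw with (⟨t, -, rfl⟩ | ⟨t, -, rfl⟩) | ⟨t, -, rfl⟩
  · exact ⟨List.cons_ne_nil _ _, hpos, hu2⟩
  · exact ⟨List.cons_ne_nil _ _, hpos, hv2⟩
  · exact ⟨List.cons_ne_nil _ _, hpos, Nat.le_add_right_of_le hu2⟩

/-- The map sending an admissible index to its multiple zeta value is
multiplicative with respect to the stuffle product: every composition
occurring in `u ⋆ v` is again admissible, and
`ζ(u)·ζ(v) = ∑_w m_w · ζ(w)` where the sum runs over `u ⋆ v`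
(with multiplicities). -/
theorem mzv_stuffle (u v : List ℕ) (hu : Admissible u) (hv : Admissible v) :
    (∀ w ∈ stuffle u v, Admissible w) ∧
      mzv u * mzv v = ((stuffle u v).map mzv).sum := by
  refine ⟨admissible_of_mem_stuffle u v hu hv, ?_⟩
  have hmul := (tendsto_truncatedMzv u hu).mul (tendsto_truncatedMzv v hv)
  simp only [truncatedMzv_mul] at hmul
  exact tendsto_nhds_unique hmul (tendsto_multiset_sum _ fun w hw =>
    tendsto_truncatedMzv w (admissible_of_mem_stuffle u v hu hv w hw))
end

section
/- (Duality theorem for multiple zeta values.) For every admissible index k, one has ζ(k) = ζ(k′), where k′ is the dual index of k. -/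
/-- The word `x^{s₁-1} y x^{s₂-1} y ⋯ x^{s_r-1} y` in the two letters
`x = false`, `y = true` encoding the composition `(s₁, …, s_r)`. -/
def wordOf (s : List ℕ) : List Bool :=
  (s.map fun p => List.replicate (p - 1) false ++ [true]).flatten

/-- Decode a word in `x = false`, `y = true` back into a composition: each
maximal block `x^{a} y` contributes an entry `a + 1`.  The auxiliary
argument counts the `x`'s read so far. -/
def decodeWord : ℕ → List Bool → List ℕ
  | _, [] => []
  | n, false :: w => decodeWord (n + 1) w
  | n, true :: w => (n + 1) :: decodeWord 0 w

/-- The dual index of `k`: reverse the word of `k` and exchange the letters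
`x` and `y`. -/
def dualIndex (k : List ℕ) : List ℕ :=
  decodeWord 0 (((wordOf k).reverse).map Bool.not)

open scoped ENNReal Nat

namespace MzvDuality

/-- The connector `n! m! / (n + m)!` of Seki and Yamamoto. -/
noncomputable def connector (n m : ℕ) : ℝ := (n ! : ℝ) * m ! / (n + m)!

theorem connector_nonneg (n m : ℕ) : 0 ≤ connector n m := by
  unfold connector; positivity

theorem connector_comm (n m : ℕ) : connector n m = connector m n := by
  unfold connector; rw [add_comm m n, mul_comm]

theorem connector_zero_right (n : ℕ) : connector n 0 = 1 := by
  unfold connector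
  have : (n ! : ℝ) ≠ 0 := by positivity
  simp [this]

theorem connector_succ_right (n m : ℕ) :
    connector n (m + 1) = connector n m * (m + 1) / (n + m + 1) := by
  have h₁ : ((n + m)! : ℝ) ≠ 0 := by positivity
  have h₂ : (n + m + 1 : ℝ) ≠ 0 := by positivity
  unfold connector
  rw [← add_assoc, Nat.factorial_succ, Nat.factorial_succ]
  push_cast
  field_simp

theorem connector_le {n : ℕ} (hn : 0 < n) (m : ℕ) : connector n m ≤ 1 / (m + 1) := by
  induction m with
  | zero => simp [connector_zero_right]
  | succ m ih =>
    have hn' : (1 : ℝ) ≤ n := by exact_mod_cast hn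
    rw [connector_succ_right]
    calc connector n m * (m + 1) / (n + m + 1)
        ≤ 1 / (m + 1) * (m + 1) / (n + m + 1) := by gcongr
      _ = 1 / (n + m + 1) := by field_simp
      _ ≤ 1 / ((m + 1 : ℕ) + 1) := by
        push_cast
        exact one_div_le_one_div_of_le (by positivity) (by linarith)

theorem tendsto_connector {n : ℕ} (hn : 0 < n) :
    Filter.Tendsto (connector n) Filter.atTop (nhds 0) :=
  squeeze_zero (connector_nonneg n) (connector_le hn) tendsto_one_div_add_atTop_nhds_zero_nat

theorem hasSum_connector {n : ℕ} (hn : 0 < n) (m : ℕ) :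
    HasSum (fun i : ℕ => ((i + (m + 1) : ℕ) : ℝ)⁻¹ * connector n (i + (m + 1)))
      ((n : ℝ)⁻¹ * connector n m) := by
  have hn' : (n : ℝ) ≠ 0 := by positivity
  rw [hasSum_iff_tendsto_nat_of_nonneg
    fun i => mul_nonneg (by positivity) (connector_nonneg _ _)]
  have hsum (N : ℕ) :
      ∑ i ∈ Finset.range N, ((i + (m + 1) : ℕ) : ℝ)⁻¹ * connector n (i + (m + 1)) =
        (n : ℝ)⁻¹ * (connector n m - connector n (N + m)) := by
    induction N with
    | zero => simp
    | succ N ih =>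
      rw [Finset.sum_range_succ, ih, show N + 1 + m = N + m + 1 by ring,
        show N + (m + 1) = N + m + 1 by ring, connector_succ_right]
      have h₁ : (N + m + 1 : ℝ) ≠ 0 := by positivity
      have h₂ : (n + (N + m) + 1 : ℝ) ≠ 0 := by positivity
      push_cast
      field_simp
      ring
  simp only [hsum]
  have := ((tendsto_connector hn).comp (Filter.tendsto_add_atTop_nat m)).const_sub (connector n m)
  simpa using this.const_mul (n : ℝ)⁻¹

/-- The transport relation for the connector. -/
theorem tsum_connector {n : ℕ} (hn : 0 < n) (m : ℕ) :
    ∑' b : ℕ, (if m < b then (b : ℝ≥0∞)⁻¹ * ENNReal.ofReal (connector n b) else 0) =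
      (n : ℝ≥0∞)⁻¹ * ENNReal.ofReal (connector n m) := by
  have hinv {b : ℕ} (hb : 0 < b) (c : ℝ) :
      (b : ℝ≥0∞)⁻¹ * ENNReal.ofReal c = ENNReal.ofReal ((b : ℝ)⁻¹ * c) := by
    rw [ENNReal.ofReal_mul (by positivity), ENNReal.ofReal_inv_of_pos (by positivity),
      ENNReal.ofReal_natCast]
  rw [← Summable.sum_add_tsum_nat_add' (k := m + 1) ENNReal.summable, Finset.sum_eq_zero, zero_add,
    hinv hn, ← (hasSum_connector hn m).tsum_eq, ENNReal.ofReal_tsum_of_nonneg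
      (fun i => mul_nonneg (by positivity) (connector_nonneg _ _)) (hasSum_connector hn m).summable]
  · refine tsum_congr fun i => ?_
    rw [if_pos (by omega), hinv (by omega)]
  · intro i hi
    rw [if_neg (by simp at hi; omega)]

/-- The part of the multiple zeta series of a word with largest summation variable `n`. -/
noncomputable def wordSum : List Bool → ℕ → ℝ≥0∞
  | [], n => if n = 0 then 1 else 0
  | false :: w, n => (n : ℝ≥0∞)⁻¹ * wordSum w n
  | true :: w, n => (n : ℝ≥0∞)⁻¹ * ∑' m : ℕ, if m < n then wordSum w m else 0

/-- Words that are empty or end in `y`. -/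
def EndsInY (w : List Bool) : Prop := ∀ a ∈ w.getLast?, a = true

theorem EndsInY.of_cons {a : Bool} {w : List Bool} (h : EndsInY (a :: w)) : EndsInY w := by
  cases w with
  | nil => simp [EndsInY]
  | cons b w => simpa [EndsInY, List.getLast?_cons_cons] using h

theorem EndsInY.ne_nil_of_false {w : List Bool} (h : EndsInY (false :: w)) : w ≠ [] := by
  rintro rfl
  simp [EndsInY] at h

theorem wordSum_zero {w : List Bool} (hw : EndsInY w) (hne : w ≠ []) : wordSum w 0 = 0 := by
  induction w with
  | nil => exact absurd rfl hne
  | cons a w ih =>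
    cases a with
    | false => simp [wordSum, ih hw.of_cons hw.ne_nil_of_false]
    | true => simp [wordSum]

/-- The connected sum of two words. -/
noncomputable def connectedSum (w v : List Bool) : ℝ≥0∞ :=
  ∑' n, ∑' m, wordSum w n * (ENNReal.ofReal (connector n m) * wordSum v m)

theorem connectedSum_comm (w v : List Bool) : connectedSum w v = connectedSum v w := by
  unfold connectedSum
  rw [ENNReal.tsum_comm]
  refine tsum_congr fun n => tsum_congr fun m => ?_
  rw [connector_comm]
  ring

theorem connectedSum_nil_right (w : List Bool) : connectedSum w [] = ∑' n, wordSum w n := by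
  unfold connectedSum
  refine tsum_congr fun n => ?_
  rw [tsum_eq_single 0 fun m hm => by simp [wordSum, hm]]
  simp [wordSum, connector_zero_right]

theorem connectedSum_false_cons {w : List Bool} (hw : EndsInY w) (hne : w ≠ []) (v : List Bool) :
    connectedSum (false :: w) v = connectedSum w (true :: v) := by
  unfold connectedSum
  refine tsum_congr fun n => ?_
  rcases Nat.eq_zero_or_pos n with rfl | hn
  · simp [wordSum, wordSum_zero hw hne]
  rw [ENNReal.tsum_mul_left]
  simp only [wordSum, ← ENNReal.tsum_mul_left]
  rw [ENNReal.tsum_comm]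
  refine tsum_congr fun m => ?_
  calc (n : ℝ≥0∞)⁻¹ * wordSum w n * (ENNReal.ofReal (connector n m) * wordSum v m)
      = wordSum w n * wordSum v m * ((n : ℝ≥0∞)⁻¹ * ENNReal.ofReal (connector n m)) := by ring
    _ = _ := by
      rw [← tsum_connector hn, ← ENNReal.tsum_mul_left]
      refine tsum_congr fun b => ?_
      split_ifs
      · ring
      · simp

theorem connectedSum_true_cons {v : List Bool} (hv : EndsInY v) (hne : v ≠ []) (w : List Bool) :
    connectedSum (true :: w) v = connectedSum w (false :: v) := by
  rw [connectedSum_comm, ← connectedSum_false_cons hv hne, connectedSum_comm]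

theorem EndsInY.cons {v : List Bool} (hv : EndsInY v) (hne : v ≠ []) (a : Bool) :
    EndsInY (a :: v) := by
  cases v with
  | nil => exact absurd rfl hne
  | cons b v => simpa [EndsInY, List.getLast?_cons_cons] using hv

theorem EndsInY.true_cons {v : List Bool} (hv : EndsInY v) : EndsInY (true :: v) := by
  cases v with
  | nil => simp [EndsInY]
  | cons b v => exact hv.cons (by simp) _

theorem connectedSum_transport {w v : List Bool} (hw : EndsInY w) (hv : EndsInY v)
    (h : v = [] → w.head? ≠ some true) :
    connectedSum w v = connectedSum [] ((w.reverse.map Bool.not) ++ v) := by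
  induction w generalizing v with
  | nil => simp
  | cons a w ih =>
    cases a with
    | false =>
      rw [connectedSum_false_cons hw.of_cons hw.ne_nil_of_false,
        ih hw.of_cons hv.true_cons (by simp)]
      simp
    | true =>
      have hne : v ≠ [] := fun hv => h hv (by simp)
      rw [connectedSum_true_cons hv hne, ih hw.of_cons (hv.cons hne _) (by simp)]
      simp

theorem tsum_wordSum_dual {w : List Bool} (hw : EndsInY w) (h : w.head? ≠ some true) :
    ∑' n, wordSum w n = ∑' n, wordSum (w.reverse.map Bool.not) n := by
  rw [← connectedSum_nil_right, connectedSum_transport hw (by simp [EndsInY]) fun _ => h,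
    connectedSum_comm, List.append_nil, connectedSum_nil_right]

theorem wordOf_cons (p : ℕ) (s : List ℕ) :
    wordOf (p :: s) = List.replicate (p - 1) false ++ true :: wordOf s := by
  simp [wordOf]

theorem wordOf_decodeWord {w : List Bool} (hw : EndsInY w) (hne : w ≠ []) (n : ℕ) :
    wordOf (decodeWord n w) = List.replicate n false ++ w := by
  induction w generalizing n with
  | nil => exact absurd rfl hne
  | cons a w ih =>
    cases a with
    | false =>
      rw [decodeWord, ih hw.of_cons hw.ne_nil_of_false, List.replicate_succ']
      simp
    | true =>
      rw [decodeWord, wordOf_cons]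
      rcases eq_or_ne w [] with rfl | hw'
      · simp [decodeWord, wordOf]
      · simp [ih hw.of_cons hw']

theorem decodeWord_pos (w : List Bool) (n : ℕ) : ∀ p ∈ decodeWord n w, 0 < p := by
  induction w generalizing n with
  | nil => simp [decodeWord]
  | cons a w ih =>
    cases a with
    | false => exact ih _
    | true => simpa [decodeWord] using ih 0

theorem endsInY_wordOf (s : List ℕ) : EndsInY (wordOf s) := by
  induction s with
  | nil => simp [EndsInY, wordOf]
  | cons p s ih =>
    rw [wordOf_cons]
    induction p - 1 with
    | zero => exact ih.true_cons
    | succ n ihn => exact ihn.cons (by simp) false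

theorem wordSum_replicate_append (k : ℕ) (w : List Bool) (n : ℕ) :
    wordSum (List.replicate k false ++ w) n = (n : ℝ≥0∞)⁻¹ ^ k * wordSum w n := by
  induction k with
  | zero => simp
  | succ k ih =>
    rw [List.replicate_succ, List.cons_append, wordSum, ih]
    ring

theorem wordSum_wordOf_cons {p : ℕ} (hp : 0 < p) (s : List ℕ) (n : ℕ) :
    wordSum (wordOf (p :: s)) n =
      (n : ℝ≥0∞)⁻¹ ^ p * ∑' m : ℕ, if m < n then wordSum (wordOf s) m else 0 := by
  obtain ⟨q, rfl⟩ : ∃ q, p = q + 1 := ⟨p - 1, by omega⟩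
  rw [wordOf_cons, wordSum_replicate_append, wordSum, Nat.add_sub_cancel, pow_succ, mul_assoc]

/-- The extended nonnegative real version of `mzvTerm`. -/
noncomputable def listTerm (s l : List ℕ) : ℝ≥0∞ :=
  ((s.zip l).map fun p => (p.2 : ℝ≥0∞)⁻¹ ^ p.1).prod

theorem toReal_listTerm (s : List ℕ) (l : MzvIndex s) :
    (listTerm s l.1).toReal = mzvTerm s l := by
  unfold listTerm mzvTerm
  induction s.zip l.1 with
  | nil => simp
  | cons p t ih => simp [ENNReal.toReal_mul, ih]

theorem listTerm_ne_top (s : List ℕ) {l : List ℕ} (hl : ∀ x ∈ l, 0 < x) : listTerm s l ≠ ∞ := by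
  induction s generalizing l with
  | nil => simp [listTerm]
  | cons p s ih =>
    cases l with
    | nil => simp [listTerm]
    | cons a l =>
      have ha : a ≠ 0 := (hl a (by simp)).ne'
      have := ih fun x hx => hl x (List.mem_cons_of_mem _ hx)
      simp only [listTerm, List.zip_cons_cons, List.map_cons, List.prod_cons]
      exact ENNReal.mul_ne_top (by simp [ha]) this

/-- An index tuple for `p :: s` is an index tuple for `s` with a larger entry put in front. -/
def mzvIndexConsEquiv (p : ℕ) (s : List ℕ) :
    {q : MzvIndex s × ℕ // q.1.1.headD 0 < q.2} ≃ MzvIndex (p :: s) where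
  toFun q := ⟨q.1.2 :: q.1.1.1, by
    obtain ⟨⟨⟨l, hl, hc, hp⟩, n⟩, h⟩ := q
    dsimp only at h ⊢
    refine ⟨by simp [hl], ?_, ?_⟩
    · cases l with
      | nil => exact List.isChain_singleton _
      | cons b l => exact List.isChain_cons_cons.2 ⟨h, hc⟩
    · simpa using ⟨by omega, hp⟩⟩
  invFun l := ⟨(⟨l.1.tail, by
    obtain ⟨l, hl, hc, hp⟩ := l
    exact ⟨by simp [hl], hc.tail, fun x hx => hp x (List.mem_of_mem_tail hx)⟩⟩, l.1.headD 0), by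
    obtain ⟨l, hl, hc, hp⟩ := l
    match l, hl with
    | [a], _ => simpa using hp
    | a :: b :: l, _ => exact (List.isChain_cons_cons.1 hc).1⟩
  left_inv q := Subtype.ext (Prod.ext (Subtype.ext rfl) rfl)
  right_inv l := by
    obtain ⟨l, hl, hc, hp⟩ := l
    cases l with
    | nil => simp at hl
    | cons a l => rfl

theorem tsum_mzvIndex_cons (p : ℕ) (s : List ℕ) (F : List ℕ → ℝ≥0∞) :
    ∑' l : MzvIndex (p :: s), F l.1 =
      ∑' l : MzvIndex s, ∑' n : ℕ, if l.1.headD 0 < n then F (n :: l.1) else 0 := by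
  rw [← (mzvIndexConsEquiv p s).tsum_eq, ← ENNReal.tsum_prod]
  refine (tsum_subtype {q : MzvIndex s × ℕ | q.1.1.headD 0 < q.2}
    fun q => F (q.2 :: q.1.1)).trans (tsum_congr fun q => ?_)
  simp only [Set.indicator_apply, Set.mem_ofPred_eq]

theorem tsum_listTerm_mul {s : List ℕ} (hs : ∀ p ∈ s, 0 < p) (g : ℕ → ℝ≥0∞) :
    ∑' l : MzvIndex s, listTerm s l.1 * g (l.1.headD 0) =
      ∑' n, wordSum (wordOf s) n * g n := by
  induction s generalizing g with
  | nil =>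
    have hl (l : MzvIndex []) : l = ⟨[], rfl, .nil, by simp⟩ := Subtype.ext (List.length_eq_zero_iff.1 l.2.1)
    rw [tsum_eq_single ⟨[], rfl, .nil, by simp⟩ fun l h => absurd (hl l) h,
      tsum_eq_single 0 fun n hn => by simp [wordOf, wordSum, hn]]
    simp [listTerm, wordOf, wordSum]
  | cons p s ih =>
    rw [tsum_mzvIndex_cons p s fun l => listTerm (p :: s) l * g (l.headD 0)]
    have key := ih (fun q hq => hs q (List.mem_cons_of_mem _ hq))
      fun m => ∑' n : ℕ, if m < n then (n : ℝ≥0∞)⁻¹ ^ p * g n else 0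
    simp only [← ENNReal.tsum_mul_left] at key
    calc _ = _ := tsum_congr fun l => tsum_congr fun n => by
            simp only [listTerm, List.zip_cons_cons, List.map_cons, List.prod_cons,
              List.headD_cons, mul_ite, mul_zero]
            exact if_congr Iff.rfl (by ring) rfl
      _ = _ := key
      _ = _ := by
        rw [ENNReal.tsum_comm]
        refine tsum_congr fun n => ?_
        rw [wordSum_wordOf_cons (hs p (by simp)), mul_right_comm, ← ENNReal.tsum_mul_left]
        refine tsum_congr fun m => ?_
        split_ifs
        · ring
        · simp

theorem mzv_eq_toReal {s : List ℕ} (hs : ∀ p ∈ s, 0 < p) :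
    mzv s = (∑' n, wordSum (wordOf s) n).toReal := by
  have h := tsum_listTerm_mul hs fun _ => 1
  simp only [mul_one] at h
  rw [← h, ENNReal.tsum_toReal_eq fun l => listTerm_ne_top s l.2.2.2, mzv]
  exact tsum_congr fun l => (toReal_listTerm s l).symm

theorem wordOf_dualIndex {k : List ℕ} (hk : Admissible k) :
    wordOf (dualIndex k) = (wordOf k).reverse.map Bool.not := by
  obtain ⟨hne, -, h2⟩ := hk
  match k, hne with
  | p :: s, _ =>
    obtain ⟨q, rfl⟩ : ∃ q, p = q + 2 := ⟨p - 2, by simp at h2; omega⟩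
    have hw : wordOf ((q + 2) :: s) = false :: (List.replicate q false ++ true :: wordOf s) := by
      rw [wordOf_cons]
      rfl
    have hy : EndsInY ((wordOf ((q + 2) :: s)).reverse.map Bool.not) := by
      rw [EndsInY, hw, List.reverse_cons, List.map_append, List.map_singleton,
        List.getLast?_concat]
      simp
    rw [dualIndex, wordOf_decodeWord hy (by simp [hw])]
    simp

theorem head?_wordOf {k : List ℕ} (hk : Admissible k) : (wordOf k).head? ≠ some true := by
  obtain ⟨hne, -, h2⟩ := hk
  match k, hne with
  | p :: s, _ =>
    obtain ⟨q, rfl⟩ : ∃ q, p = q + 2 := ⟨p - 2, by simp at h2; omega⟩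
    simp [wordOf_cons, List.replicate_succ]

end MzvDuality

open MzvDuality in
/-- Duality theorem for multiple zeta values: `ζ(k) = ζ(k′)` for every
admissible index `k`, where `k′` is the dual index of `k`. -/
theorem mzv_duality (k : List ℕ) (hk : Admissible k) :
    mzv k = mzv (dualIndex k) := by
  rw [mzv_eq_toReal hk.2.1, mzv_eq_toReal (s := dualIndex k) (decodeWord_pos _ _),
    wordOf_dualIndex hk, tsum_wordSum_dual (endsInY_wordOf k) (head?_wordOf hk)]
end

section
/- (Ohno's theorem.) Let k = (s_1, …, s_r) be an admissible index and let k′ = (s′_1, …, s′_{r′}) be its dual index. Then for every integer m ≥ 0: ∑_{c_1 + ⋯ + c_r = m, c_i ≥ 0} ζ(s_1 + c_1, …, s_r + c_r) = ∑_{c_1 + ⋯ + c_{r′} = m, c_i ≥ 0} ζ(s′_1 + c_1, …, s′_{r′} + c_{r′}), where both sums run over all tuples of nonnegative integers with the indicated total. -/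
open Finset Filter Topology
open scoped ENNReal

/-- The weight `1/n` of the letter `x`, with value `0` at `n = 0`. -/
noncomputable def invWeight (n : ℕ) : ℝ≥0∞ := ENNReal.ofReal (1 / n)

/-- The weight `1/(n - x)` of the letter `y`, with value `0` at `n = 0`. -/
noncomputable def shiftedInvWeight (x : ℝ) (n : ℕ) : ℝ≥0∞ := ENNReal.ofReal (1 / (n - x))

/-- The shifted factorial `(1 - x)(2 - x) ⋯ (n - x)`. -/
noncomputable def shiftedFactorial (x : ℝ) (n : ℕ) : ℝ := ∏ i ∈ range n, ((i : ℝ) + 1 - x)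

/-- The Seki–Yamamoto connector with parameter `x`. -/
noncomputable def connector (x : ℝ) (m n : ℕ) : ℝ :=
  shiftedFactorial x m * shiftedFactorial x n / shiftedFactorial x (m + n)

section Connector

variable {x : ℝ}

lemma shiftedFactorial_succ (x : ℝ) (n : ℕ) :
    shiftedFactorial x (n + 1) = shiftedFactorial x n * ((n : ℝ) + 1 - x) :=
  prod_range_succ _ _

lemma natCast_add_one_sub_pos (hx : x < 1) (n : ℕ) : 0 < (n : ℝ) + 1 - x := by
  have : (0 : ℝ) ≤ n := n.cast_nonneg
  linarith

lemma shiftedFactorial_pos (hx : x < 1) (n : ℕ) : 0 < shiftedFactorial x n :=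
  prod_pos fun i _ => natCast_add_one_sub_pos hx i

lemma connector_pos (hx : x < 1) (m n : ℕ) : 0 < connector x m n :=
  div_pos (mul_pos (shiftedFactorial_pos hx m) (shiftedFactorial_pos hx n))
    (shiftedFactorial_pos hx _)

lemma connector_comm (x : ℝ) (m n : ℕ) : connector x m n = connector x n m := by
  rw [connector, connector, add_comm m n, mul_comm (shiftedFactorial x m)]

lemma connector_zero_right (hx : x < 1) (m : ℕ) : connector x m 0 = 1 := by
  have := (shiftedFactorial_pos hx m).ne'
  simp [connector, shiftedFactorial] at this ⊢
  exact this

lemma connector_one_left (hx : x < 1) (n : ℕ) :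
    connector x 1 n = (1 - x) / ((n : ℝ) + 1 - x) := by
  have h := (shiftedFactorial_pos hx n).ne'
  have h' := (natCast_add_one_sub_pos hx n).ne'
  rw [connector, add_comm 1 n, shiftedFactorial_succ x n]
  simp only [shiftedFactorial, prod_range_one] at h ⊢
  field_simp
  simp

/-- The difference equation satisfied by the connector. -/
lemma connector_sub_succ (hx : x < 1) {m : ℕ} (hm : 0 < m) (n : ℕ) :
    1 / ((n : ℝ) + 1 - x) * connector x m (n + 1) =
      1 / (m : ℝ) * (connector x m n - connector x m (n + 1)) := by
  have h1 := (shiftedFactorial_pos hx n).ne'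
  have h2 := (natCast_add_one_sub_pos hx n).ne'
  have h3 := (shiftedFactorial_pos hx (m + n)).ne'
  have h4 := (natCast_add_one_sub_pos hx (m + n)).ne'
  have h5 : (m : ℝ) ≠ 0 := by positivity
  rw [connector, connector, ← add_assoc, shiftedFactorial_succ, shiftedFactorial_succ]
  push_cast at h4 ⊢
  field_simp
  ring

lemma connector_succ_left_le (hx : x < 1) (m n : ℕ) :
    connector x (m + 1) n ≤ connector x m n := by
  rcases Nat.eq_zero_or_pos n with rfl | hn
  · simp [connector_zero_right hx]
  have h := connector_sub_succ hx hn m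
  rw [connector_comm x n, connector_comm x n] at h
  have h1 : 0 < 1 / ((m : ℝ) + 1 - x) * connector x (m + 1) n :=
    mul_pos (one_div_pos.2 (natCast_add_one_sub_pos hx m)) (connector_pos hx _ _)
  rw [h] at h1
  have := (pos_iff_pos_of_mul_pos h1).1 (by positivity)
  linarith

lemma tendsto_connector_atTop (hx : x < 1) {m : ℕ} (hm : 0 < m) :
    Tendsto (fun n => connector x m n) atTop (𝓝 0) := by
  have hanti (n : ℕ) : Antitone fun m => connector x m n :=
    antitone_nat_of_succ_le fun m => connector_succ_left_le hx m n
  have hle (n : ℕ) : connector x m n ≤ (1 - x) / ((n : ℝ) + 1 - x) :=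
    (hanti n hm).trans_eq (connector_one_left hx n)
  refine squeeze_zero (fun n => (connector_pos hx m n).le) hle ?_
  refine Tendsto.const_div_atTop ?_ _
  simp only [add_sub_assoc]
  exact tendsto_atTop_add_const_right _ _ tendsto_natCast_atTop_atTop

/-- Summing the connector against the weights of `y` produces the weight of `x`. -/
lemma tsum_shiftedInvWeight_mul_connector (hx : x < 1) {m : ℕ} (hm : 0 < m) (n : ℕ) :
    ∑' b, (if n < b then shiftedInvWeight x b * ENNReal.ofReal (connector x m b) else 0) =
      invWeight m * ENNReal.ofReal (connector x m n) := by
  have hinj : Function.Injective fun i : ℕ => n + i + 1 := fun i j h => by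
    simpa using h
  rw [← hinj.tsum_eq]
  · have hsum : HasSum
        (fun i => 1 / (((n + i : ℕ) : ℝ) + 1 - x) * connector x m (n + i + 1))
        (1 / (m : ℝ) * connector x m n) := by
      rw [hasSum_iff_tendsto_nat_of_nonneg]
      · simp_rw [connector_sub_succ hx hm, ← mul_sum]
        refine Tendsto.const_mul _ ?_
        have hs (N : ℕ) : ∑ i ∈ range N, (connector x m (n + i) - connector x m (n + i + 1)) =
            connector x m n - connector x m (N + n) := by
          simpa [add_assoc, add_comm N] using
            sum_range_sub' (fun i => connector x m (n + i)) N
        simp_rw [hs]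
        simpa using ((tendsto_add_atTop_iff_nat n).2 (tendsto_connector_atTop hx hm)).const_sub
          (connector x m n)
      · exact fun i => (mul_pos (one_div_pos.2 (natCast_add_one_sub_pos hx _))
          (connector_pos hx _ _)).le
    rw [invWeight, ← ENNReal.ofReal_mul (by positivity), ← hsum.tsum_eq,
      ENNReal.ofReal_tsum_of_nonneg _ hsum.summable]
    · refine tsum_congr fun i => ?_
      rw [if_pos (by omega), shiftedInvWeight, ← ENNReal.ofReal_mul]
      · push_cast; rfl
      · have := natCast_add_one_sub_pos hx (n + i)
        push_cast at this ⊢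
        exact (one_div_pos.2 this).le
    · exact fun i => (mul_pos (one_div_pos.2 (natCast_add_one_sub_pos hx _))
          (connector_pos hx _ _)).le
  · intro b hb
    have : n < b := by
      by_contra h
      simp [h] at hb
    exact ⟨b - n - 1, by simp only; omega⟩

end Connector

/-- The total weight of the configurations attached to a word (`x = false`, `y = true`) whose
outermost summation variable equals `n`. -/
noncomputable def wordSum (x : ℝ) : List Bool → ℕ → ℝ≥0∞
  | [], n => if n = 0 then 1 else 0
  | false :: w, n => invWeight n * wordSum x w n
  | true :: w, n => shiftedInvWeight x n * ∑' n', if n' < n then wordSum x w n' else 0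

/-- The connected sum of two words. -/
noncomputable def connectedSum (x : ℝ) (w v : List Bool) : ℝ≥0∞ :=
  ∑' m, ∑' n, wordSum x w m * wordSum x v n * ENNReal.ofReal (connector x m n)

section ConnectedSum

variable {x : ℝ}

lemma invWeight_zero : invWeight 0 = 0 := by simp [invWeight]

lemma invWeight_le_one (n : ℕ) : invWeight n ≤ 1 := by
  rw [invWeight, ENNReal.ofReal_le_one, one_div]
  exact Nat.cast_inv_le_one n

lemma wordSum_cons_zero (x : ℝ) (a : Bool) (w : List Bool) : wordSum x (a :: w) 0 = 0 := by
  cases a <;> simp [wordSum, invWeight_zero]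

lemma connectedSum_comm (x : ℝ) (w v : List Bool) : connectedSum x w v = connectedSum x v w := by
  rw [connectedSum, ENNReal.tsum_comm, connectedSum]
  simp_rw [connector_comm x, mul_comm (wordSum x w _)]

/-- Summing a function against `wordSum x (true :: w)`. -/
lemma tsum_wordSum_true_mul (x : ℝ) (w : List Bool) (g : ℕ → ℝ≥0∞) :
    ∑' n, wordSum x (true :: w) n * g n =
      ∑' n, wordSum x w n * ∑' b, if n < b then shiftedInvWeight x b * g b else 0 := by
  simp_rw [← ENNReal.tsum_mul_left]
  rw [ENNReal.tsum_comm]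
  refine tsum_congr fun b => ?_
  rw [wordSum, mul_right_comm, ← ENNReal.tsum_mul_left]
  refine tsum_congr fun n => ?_
  split_ifs <;> simp [mul_comm]

lemma connectedSum_false_cons (hx : x < 1) {w : List Bool} (hw : w ≠ []) (v : List Bool) :
    connectedSum x (false :: w) v = connectedSum x w (true :: v) := by
  obtain ⟨a, w, rfl⟩ := List.exists_cons_of_ne_nil hw
  refine tsum_congr fun m => ?_
  rcases Nat.eq_zero_or_pos m with rfl | hm
  · simp [wordSum_cons_zero]
  simp_rw [mul_assoc, ENNReal.tsum_mul_left, tsum_wordSum_true_mul,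
    tsum_shiftedInvWeight_mul_connector hx hm]
  rw [wordSum, mul_assoc, mul_left_comm, ← ENNReal.tsum_mul_left]
  simp_rw [mul_left_comm]

lemma connectedSum_true_cons (hx : x < 1) {v : List Bool} (w : List Bool) (hv : v ≠ []) :
    connectedSum x (true :: w) v = connectedSum x w (false :: v) := by
  rw [connectedSum_comm, ← connectedSum_false_cons hx hv, connectedSum_comm]

lemma connectedSum_nil_right (hx : x < 1) (w : List Bool) :
    connectedSum x w [] = ∑' n, wordSum x w n := by
  refine tsum_congr fun m => ?_
  rw [tsum_eq_single 0 fun n hn => by simp [wordSum, hn]]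
  simp [wordSum, connector_zero_right hx]

lemma connectedSum_transport (hx : x < 1) (w : List Bool) {v : List Bool} (hv : v ≠ []) :
    connectedSum x (w ++ [true]) v =
      connectedSum x [] (((w ++ [true]).reverse).map Bool.not ++ v) := by
  induction w generalizing v with
  | nil => simpa using connectedSum_true_cons hx [] hv
  | cons a w ih =>
    cases a
    · rw [List.cons_append, connectedSum_false_cons hx (by simp), ih (by simp)]
      simp
    · rw [List.cons_append, connectedSum_true_cons hx _ hv, ih (by simp)]
      simp

/-- Duality for the generating functions attached to words. -/
lemma tsum_wordSum_dual (hx : x < 1) (w : List Bool) :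
    ∑' n, wordSum x (false :: (w ++ [true])) n =
      ∑' n, wordSum x (((false :: (w ++ [true])).reverse).map Bool.not) n := by
  rw [← connectedSum_nil_right hx, ← connectedSum_nil_right hx,
    connectedSum_false_cons hx (by simp), connectedSum_transport hx w (by simp),
    connectedSum_comm]
  simp

lemma tsum_wordSum_mul_connector_one_le (hx : x < 1) (w : List Bool) :
    ∑' n, wordSum x w n * ENNReal.ofReal (connector x 1 n) ≤ 1 := by
  induction w with
  | nil =>
    rw [tsum_eq_single 0 fun n hn => by simp [wordSum, hn]]
    simp [wordSum, connector_zero_right hx]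
  | cons a w ih =>
    refine le_trans ?_ ih
    cases a
    · refine ENNReal.tsum_le_tsum fun n => ?_
      rw [wordSum]
      gcongr
      exact mul_le_of_le_one_left' (invWeight_le_one n)
    · rw [tsum_wordSum_true_mul]
      simp_rw [tsum_shiftedInvWeight_mul_connector hx one_pos]
      simp [invWeight]

lemma tsum_wordSum_half_ne_top (w : List Bool) :
    ∑' n, wordSum (1 / 2) (false :: w) n ≠ ∞ := by
  have hx : (1 / 2 : ℝ) < 1 := by norm_num
  have h (n : ℕ) : invWeight n ≤ 4 * ENNReal.ofReal (connector (1 / 2) 1 n) := by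
    rw [invWeight, connector_one_left hx, ← ENNReal.ofReal_ofNat 4,
      ← ENNReal.ofReal_mul (by norm_num)]
    refine ENNReal.ofReal_le_ofReal ?_
    rcases Nat.eq_zero_or_pos n with rfl | hn
    · norm_num
    have : (1 : ℝ) ≤ n := by exact_mod_cast hn
    rw [mul_div_assoc', div_le_div_iff₀ (by positivity) (by linarith)]
    linarith
  refine ne_top_of_le_ne_top (b := 4 * 1) (by simp) ?_
  calc ∑' n, wordSum (1 / 2) (false :: w) n
      ≤ ∑' n, 4 * (wordSum (1 / 2) w n * ENNReal.ofReal (connector (1 / 2) 1 n)) := by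
        refine ENNReal.tsum_le_tsum fun n => ?_
        rw [wordSum, mul_left_comm, mul_comm]
        gcongr
        exact h n
    _ ≤ 4 * 1 := by
        rw [ENNReal.tsum_mul_left]
        gcongr
        exact tsum_wordSum_mul_connector_one_le hx w

end ConnectedSum

/-- The sum of the terms of the multiple zeta series of `s` whose outermost summation variable
equals `n`. -/
noncomputable def nestedSum : List ℕ → ℕ → ℝ≥0∞
  | [], n => if n = 0 then 1 else 0
  | s :: t, n => invWeight n ^ s * ∑' n', if n' < n then nestedSum t n' else 0

/-- The term of the multiple zeta series of a composition at a list of summation variables,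
extended by zero to all lists. -/
noncomputable def listTerm : List ℕ → List ℕ → ℝ≥0∞
  | [], [] => 1
  | s :: t, n :: l => invWeight n ^ s * if l.headI < n then listTerm t l else 0
  | _, _ => 0

section Mzv

lemma nestedSum_eq_tsum (s : List ℕ) (n : ℕ) :
    nestedSum s n = ∑' l : List ℕ, if l.headI = n then listTerm s l else 0 := by
  induction s generalizing n with
  | nil =>
    rw [tsum_eq_single []]
    · simp [nestedSum, listTerm, eq_comm]
    · rintro (_ | ⟨a, l⟩) hl
      · exact absurd rfl hl
      · simp only [listTerm, ite_self]
  | cons s t ih =>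
    have hinj : Function.Injective fun p : ℕ × List ℕ => p.1 :: p.2 := by
      rintro ⟨a, l⟩ ⟨b, l'⟩ h
      simpa using h
    rw [← hinj.tsum_eq, ENNReal.tsum_prod', tsum_eq_single n]
    · simp_rw [nestedSum, ih, listTerm, List.headI_cons, if_true, ENNReal.tsum_mul_left]
      congr 1
      calc ∑' n', (if n' < n then ∑' l : List ℕ, if l.headI = n' then listTerm t l else 0 else 0)
          = ∑' n', ∑' l : List ℕ,
              if l.headI = n' then (if n' < n then listTerm t l else 0) else 0 := by
            refine tsum_congr fun n' => ?_
            split_ifs <;> simp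
        _ = ∑' l : List ℕ, if l.headI < n then listTerm t l else 0 := by
            rw [ENNReal.tsum_comm]
            refine tsum_congr fun l => ?_
            rw [tsum_eq_single l.headI fun n' hn' => if_neg hn'.symm, if_pos rfl]
    · intro a ha
      simp [ha]
    · rintro (_ | ⟨a, l⟩) hl
      · exact absurd (by simp only [listTerm, ite_self]) hl
      · exact ⟨(a, l), rfl⟩

lemma tsum_nestedSum (s : List ℕ) : ∑' n, nestedSum s n = ∑' l, listTerm s l := by
  simp_rw [nestedSum_eq_tsum]
  rw [ENNReal.tsum_comm]
  refine tsum_congr fun l => ?_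
  rw [tsum_eq_single l.headI fun n' hn' => if_neg hn'.symm, if_pos rfl]

lemma listTerm_ne_top (s l : List ℕ) : listTerm s l ≠ ∞ := by
  induction s generalizing l with
  | nil => cases l <;> simp [listTerm]
  | cons s t ih =>
    cases l with
    | nil => simp [listTerm]
    | cons n l =>
      rw [listTerm]
      refine ENNReal.mul_ne_top (ENNReal.pow_ne_top ENNReal.ofReal_ne_top) ?_
      split_ifs
      · exact ih l
      · simp

lemma headI_lt_iff {n : ℕ} {l : List ℕ} :
    l.headI < n ↔ 0 < n ∧ ∀ y ∈ l.head?, n > y := by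
  cases l <;> simp; omega

lemma listTerm_eq_zero {s l : List ℕ}
    (h : ¬(l.length = s.length ∧ l.IsChain (· > ·) ∧ ∀ x ∈ l, 0 < x)) : listTerm s l = 0 := by
  induction s generalizing l with
  | nil =>
    cases l with
    | nil => simp at h
    | cons n l => simp [listTerm]
  | cons s t ih =>
    cases l with
    | nil => simp [listTerm]
    | cons n l =>
      rw [listTerm]
      split_ifs with hlt
      · rw [ih, mul_zero]
        contrapose! h
        obtain ⟨h1, h2, h3⟩ := h
        obtain ⟨hn, hlt⟩ := headI_lt_iff.1 hlt
        refine ⟨by simp [h1], List.isChain_cons.2 ⟨hlt, h2⟩, ?_⟩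
        simpa using ⟨hn, h3⟩
      · simp

lemma toReal_listTerm {s l : List ℕ} (hl : l.length = s.length) (hc : l.IsChain (· > ·))
    (hp : ∀ x ∈ l, 0 < x) :
    (listTerm s l).toReal = ((s.zip l).map fun p => (1 : ℝ) / (p.2 : ℝ) ^ p.1).prod := by
  induction s generalizing l with
  | nil =>
    obtain rfl := List.length_eq_zero_iff.1 hl
    simp [listTerm]
  | cons s t ih =>
    cases l with
    | nil => simp at hl
    | cons n l =>
      obtain ⟨h1, h2⟩ := List.isChain_cons.1 hc
      have h0 : l.headI < n := headI_lt_iff.2 ⟨hp n (by simp), h1⟩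
      rw [listTerm, if_pos h0, ENNReal.toReal_mul,
        ih (by simpa using hl) h2 fun x hx => hp x (by simp [hx]), ENNReal.toReal_pow, invWeight,
        ENNReal.toReal_ofReal (by positivity)]
      simp

lemma mzv_eq_toReal (s : List ℕ) : mzv s = (∑' n, nestedSum s n).toReal := by
  have h1 : mzv s = ∑' n : MzvIndex s, (listTerm s n.1).toReal :=
    tsum_congr fun n => (toReal_listTerm n.2.1 n.2.2.1 n.2.2.2).symm
  have hinj : Function.Injective fun n : MzvIndex s => n.1 := Subtype.val_injective
  rw [h1, tsum_nestedSum, ENNReal.tsum_toReal_eq (listTerm_ne_top s)]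
  refine hinj.tsum_eq (f := fun l => (listTerm s l).toReal) fun l hl => ?_
  by_contra h
  exact hl (by simp only [listTerm_eq_zero fun h' => h ⟨⟨l, h'⟩, rfl⟩, ENNReal.toReal_zero])

lemma tsum_pow_mul_invWeight_pow {x : ℝ} (hx0 : 0 ≤ x) (hx : x < 1) (n : ℕ) :
    ∑' c, ENNReal.ofReal x ^ c * invWeight n ^ (c + 1) = shiftedInvWeight x n := by
  rcases Nat.eq_zero_or_pos n with rfl | hn
  · simp [invWeight_zero, shiftedInvWeight, hx0]
  have hn' : (1 : ℝ) ≤ n := by exact_mod_cast hn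
  have h0 : 0 ≤ x / n := by positivity
  have h1 : x / n < 1 := (div_lt_one (by positivity)).2 (by linarith)
  have hgeo := (hasSum_geometric_of_lt_one h0 h1).mul_left (1 / (n : ℝ))
  have hval : 1 / (n : ℝ) * (1 - x / n)⁻¹ = 1 / (n - x) := by
    have : (n : ℝ) - x ≠ 0 := by linarith
    have : 1 - x / n ≠ 0 := by linarith
    field_simp
  rw [hval] at hgeo
  rw [shiftedInvWeight, ← hgeo.tsum_eq, ENNReal.ofReal_tsum_of_nonneg _ hgeo.summable]
  · refine tsum_congr fun c => ?_
    rw [invWeight, ← ENNReal.ofReal_pow hx0, ← ENNReal.ofReal_pow (by positivity),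
      ← ENNReal.ofReal_mul (by positivity)]
    congr 1
    rw [div_pow, div_pow, one_pow, pow_succ]
    field_simp
  · exact fun c => by positivity

lemma wordSum_replicate_append (x : ℝ) (a : ℕ) (w : List Bool) (n : ℕ) :
    wordSum x (List.replicate a false ++ w) n = invWeight n ^ a * wordSum x w n := by
  induction a with
  | zero => simp
  | succ a ih => rw [List.replicate_succ, List.cons_append, wordSum, ih, pow_succ', mul_assoc]

lemma tsum_pow_mul_nestedSum {x : ℝ} (hx0 : 0 ≤ x) (hx : x < 1) (k : List ℕ)
    (hk : ∀ s ∈ k, 0 < s) (n : ℕ) :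
    ∑' c : Fin k.length → ℕ, ENNReal.ofReal x ^ (∑ i, c i) *
        nestedSum (List.ofFn fun i => k.get i + c i) n = wordSum x (wordOf k) n := by
  induction k generalizing n with
  | nil =>
    have : IsEmpty (Fin ([] : List ℕ).length) := Fin.isEmpty'
    rw [tsum_eq_single default fun c hc => absurd (Subsingleton.elim _ _) hc]
    simp [wordOf, nestedSum, wordSum]
  | cons s t ih =>
    have ih := ih fun s hs => hk s (by simp [hs])
    obtain ⟨a, rfl⟩ : ∃ a, s = a + 1 := ⟨s - 1, by have := hk s (by simp); omega⟩
    have hw : wordOf ((a + 1) :: t) = List.replicate a false ++ true :: wordOf t := by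
      simp [wordOf]
    rw [hw, wordSum_replicate_append, wordSum, ← tsum_pow_mul_invWeight_pow hx0 hx]
    simp_rw [← ih]
    refine ((Fin.consEquiv fun _ : Fin (t.length + 1) => ℕ).tsum_eq _).symm.trans ?_
    rw [ENNReal.tsum_prod', ← ENNReal.tsum_mul_right, ← ENNReal.tsum_mul_left]
    refine tsum_congr fun b => ?_
    have hcomm : (∑' n', if n' < n then ∑' c : Fin t.length → ℕ, ENNReal.ofReal x ^ (∑ i, c i) *
          nestedSum (List.ofFn fun i => t.get i + c i) n' else 0) =
        ∑' c : Fin t.length → ℕ, ENNReal.ofReal x ^ (∑ i, c i) *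
          ∑' n', if n' < n then nestedSum (List.ofFn fun i => t.get i + c i) n' else 0 := by
      simp_rw [← ENNReal.tsum_mul_left]
      rw [ENNReal.tsum_comm]
      refine tsum_congr fun n' => ?_
      split_ifs <;> simp
    rw [hcomm, ← ENNReal.tsum_mul_left, ← ENNReal.tsum_mul_left]
    refine tsum_congr fun c => ?_
    have hsum : ∑ i, (Fin.consEquiv fun _ : Fin (t.length + 1) => ℕ) (b, c) i = b + ∑ i, c i := by
      simp [Fin.consEquiv, Fin.sum_univ_succ]
    have hlist : (List.ofFn fun i => ((a + 1) :: t).get i +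
        (Fin.consEquiv fun _ : Fin (t.length + 1) => ℕ) (b, c) i) =
          (a + 1 + b) :: List.ofFn fun i => t.get i + c i := by
      simp [Fin.consEquiv, List.ofFn_succ]
    erw [hsum, hlist]
    rw [nestedSum]
    ring

lemma tsum_pow_mul_sum_antidiagonalTuple {x : ℝ} (hx0 : 0 ≤ x) (hx : x < 1) (k : List ℕ)
    (hk : ∀ s ∈ k, 0 < s) :
    ∑' m, ENNReal.ofReal x ^ m * ∑ c ∈ Finset.Nat.antidiagonalTuple k.length m,
        ∑' n, nestedSum (List.ofFn fun i => k.get i + c i) n = ∑' n, wordSum x (wordOf k) n := by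
  simp_rw [← tsum_pow_mul_nestedSum hx0 hx k hk]
  rw [ENNReal.tsum_comm]
  simp_rw [ENNReal.tsum_mul_left]
  rw [← (Finset.Nat.sigmaAntidiagonalTupleEquivTuple k.length).tsum_eq, ENNReal.tsum_sigma']
  refine tsum_congr fun m => ?_
  rw [tsum_fintype, mul_sum, ← sum_coe_sort]
  refine sum_congr rfl fun c _ => ?_
  simp [Finset.Nat.mem_antidiagonalTuple.1 c.2]

end Mzv

/-- The constant term of a convergent power series over `ℝ≥0∞` is bounded by that of any other
one taking the same values at small positive arguments. -/
lemma le_of_forall_tsum_pow_mul_eq {a b : ℕ → ℝ≥0∞}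
    (hb : ∑' m, ENNReal.ofReal (1 / 2) ^ m * b m ≠ ∞)
    (h : ∀ x : ℝ, 0 < x → x ≤ 1 / 2 →
      ∑' m, ENNReal.ofReal x ^ m * a m = ∑' m, ENNReal.ofReal x ^ m * b m) :
    a 0 ≤ b 0 := by
  set B := ∑' m, ENNReal.ofReal (1 / 2) ^ m * b (m + 1) with hB
  have hB' : B ≠ ∞ := by
    intro hBt
    rw [tsum_eq_zero_add' ENNReal.summable] at hb
    simp_rw [pow_succ', mul_assoc, ENNReal.tsum_mul_left] at hb
    rw [← hB, hBt] at hb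
    simp [ENNReal.mul_top] at hb
  have hle (x : ℝ) (hx : 0 < x) (hx' : x ≤ 1 / 2) : a 0 ≤ b 0 + ENNReal.ofReal x * B := by
    calc a 0 = ENNReal.ofReal x ^ 0 * a 0 := by simp
      _ ≤ ∑' m, ENNReal.ofReal x ^ m * a m :=
        ENNReal.le_tsum (f := fun m => ENNReal.ofReal x ^ m * a m) 0
      _ = ∑' m, ENNReal.ofReal x ^ m * b m := h x hx hx'
      _ = b 0 + ENNReal.ofReal x * ∑' m, ENNReal.ofReal x ^ m * b (m + 1) := by
        rw [tsum_eq_zero_add' ENNReal.summable]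
        simp_rw [pow_succ', mul_assoc, ENNReal.tsum_mul_left]
        simp
      _ ≤ b 0 + ENNReal.ofReal x * B := by
        rw [hB]
        gcongr
  have hlim : Tendsto (fun x : ℝ => b 0 + ENNReal.ofReal x * B) (𝓝[>] 0)
      (𝓝 (b 0 + ENNReal.ofReal 0 * B)) := by
    refine Tendsto.mono_left ?_ nhdsWithin_le_nhds
    exact tendsto_const_nhds.add (ENNReal.Tendsto.mul_const
      (ENNReal.continuous_ofReal.tendsto 0) (Or.inr hB'))
  rw [ENNReal.ofReal_zero, zero_mul, add_zero] at hlim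
  refine ge_of_tendsto hlim ?_
  filter_upwards [Ioc_mem_nhdsGT (show (0 : ℝ) < 1 / 2 by norm_num)] with x hx
  exact hle x hx.1 hx.2

/-- The coefficients of a convergent power series over `ℝ≥0∞` are determined by its values at
small positive arguments. -/
lemma eq_of_forall_tsum_pow_mul_eq {a b : ℕ → ℝ≥0∞}
    (ha : ∑' m, ENNReal.ofReal (1 / 2) ^ m * a m ≠ ∞)
    (h : ∀ x : ℝ, 0 < x → x ≤ 1 / 2 →
      ∑' m, ENNReal.ofReal x ^ m * a m = ∑' m, ENNReal.ofReal x ^ m * b m) (m : ℕ) :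
    a m = b m := by
  induction m generalizing a b with
  | zero =>
    refine le_antisymm (le_of_forall_tsum_pow_mul_eq ?_ h)
      (le_of_forall_tsum_pow_mul_eq ha fun x hx hx' => (h x hx hx').symm)
    rwa [← h _ (by norm_num) le_rfl]
  | succ m ih =>
    have h0 : a 0 = b 0 :=
      le_antisymm (le_of_forall_tsum_pow_mul_eq (by rwa [← h _ (by norm_num) le_rfl]) h)
        (le_of_forall_tsum_pow_mul_eq ha fun x hx hx' => (h x hx hx').symm)
    have hsplit (f : ℕ → ℝ≥0∞) (x : ℝ) : ∑' m, ENNReal.ofReal x ^ m * f m =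
        f 0 + ENNReal.ofReal x * ∑' m, ENNReal.ofReal x ^ m * f (m + 1) := by
      rw [tsum_eq_zero_add' ENNReal.summable]
      simp_rw [pow_succ', mul_assoc, ENNReal.tsum_mul_left]
      simp
    rw [hsplit] at ha
    have ha0 : a 0 ≠ ∞ := (ENNReal.add_ne_top.1 ha).1
    refine ih (a := fun m => a (m + 1)) (b := fun m => b (m + 1)) ?_ fun x hx hx' => ?_
    · intro ht
      rw [ht, ENNReal.mul_top (by simp)] at ha
      simp at ha
    · have := h x hx hx'
      rw [hsplit a, hsplit b, ← h0, ENNReal.add_right_inj ha0] at this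
      exact (ENNReal.mul_right_inj (by simpa using hx) ENNReal.ofReal_ne_top).1 this

section Words

lemma wordOf_decodeWord (n : ℕ) (w : List Bool) :
    wordOf (decodeWord n (w ++ [true])) = List.replicate n false ++ (w ++ [true]) := by
  induction w generalizing n with
  | nil => simp [decodeWord, wordOf]
  | cons a w ih =>
    cases a
    · simp [decodeWord, ih, List.replicate_succ']
    · have := ih 0
      simp [wordOf] at this
      simp [decodeWord, wordOf, this]

lemma pos_of_mem_decodeWord (n : ℕ) (w : List Bool) : ∀ s ∈ decodeWord n w, 0 < s := by
  induction w generalizing n with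
  | nil => simp [decodeWord]
  | cons a w ih =>
    cases a
    · exact ih (n + 1)
    · simpa [decodeWord] using ih 0

lemma pos_of_mem_dualIndex (k : List ℕ) : ∀ s ∈ dualIndex k, 0 < s :=
  pos_of_mem_decodeWord _ _

lemma exists_wordOf_eq_append {k : List ℕ} (hk : k ≠ []) :
    ∃ w, wordOf k = w ++ [true] := by
  obtain ⟨l, s, rfl⟩ := (List.eq_nil_or_concat' k).resolve_left hk
  exact ⟨wordOf l ++ List.replicate (s - 1) false, by simp [wordOf]⟩

lemma Admissible.exists_wordOf_eq {k : List ℕ} (hk : Admissible k) :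
    ∃ w, wordOf k = false :: (w ++ [true]) := by
  obtain ⟨hne, -, hs⟩ := hk
  obtain ⟨u, hu⟩ := exists_wordOf_eq_append hne
  obtain ⟨s, t, rfl⟩ := List.exists_cons_of_ne_nil hne
  obtain ⟨a, rfl⟩ : ∃ a, s = a + 2 := ⟨s - 2, by simp at hs; omega⟩
  have hfalse : ∃ v, wordOf ((a + 2) :: t) = false :: v :=
    ⟨List.replicate a false ++ true :: wordOf t, by simp [wordOf, List.replicate_succ]⟩
  obtain ⟨v, hv⟩ := hfalse
  rw [hv] at hu
  cases u with
  | nil => simp at hu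
  | cons b u =>
    simp only [List.cons_append, List.cons.injEq] at hu
    exact ⟨u, by rw [hv, hu.2]⟩

lemma wordOf_dualIndex {k : List ℕ} (hk : Admissible k) :
    wordOf (dualIndex k) = ((wordOf k).reverse).map Bool.not := by
  obtain ⟨w, hw⟩ := hk.exists_wordOf_eq
  have : ((wordOf k).reverse).map Bool.not = ((w ++ [true]).reverse.map Bool.not) ++ [true] := by
    simp [hw]
  rw [dualIndex, this, wordOf_decodeWord]
  simp

end Words

/-- Ohno's theorem: for an admissible index `k` with dual index `k′` and any
`m ≥ 0`, the sum of `ζ(k + c)` over all ways of adding nonnegative integers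
`c₁, …, c_r` with total `m` to the entries of `k` equals the corresponding
sum for `k′`. -/
theorem mzv_ohno (k : List ℕ) (hk : Admissible k) (m : ℕ) :
    ∑ c ∈ Finset.Nat.antidiagonalTuple k.length m,
        mzv (List.ofFn fun i => k.get i + c i) =
      ∑ c ∈ Finset.Nat.antidiagonalTuple (dualIndex k).length m,
        mzv (List.ofFn fun i => (dualIndex k).get i + c i) := by
  set S : List ℕ → ℕ → ℝ≥0∞ := fun k m => ∑ c ∈ Finset.Nat.antidiagonalTuple k.length m,
    ∑' n, nestedSum (List.ofFn fun i => k.get i + c i) n with hS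
  obtain ⟨w, hw⟩ := hk.exists_wordOf_eq
  have hgen (x : ℝ) (hx0 : 0 ≤ x) (hx : x < 1) :
      ∑' m, ENNReal.ofReal x ^ m * S k m = ∑' m, ENNReal.ofReal x ^ m * S (dualIndex k) m := by
    rw [hS, tsum_pow_mul_sum_antidiagonalTuple hx0 hx k hk.2.1,
      tsum_pow_mul_sum_antidiagonalTuple hx0 hx _ (pos_of_mem_dualIndex k),
      wordOf_dualIndex hk, hw, tsum_wordSum_dual hx]
  have hfin : ∑' m, ENNReal.ofReal (1 / 2) ^ m * S k m ≠ ∞ := by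
    rw [hS, tsum_pow_mul_sum_antidiagonalTuple (by norm_num) (by norm_num) k hk.2.1, hw]
    exact tsum_wordSum_half_ne_top _
  have hreal (l : List ℕ) (hl : ∑' m, ENNReal.ofReal (1 / 2) ^ m * S l m ≠ ∞) :
      ∑ c ∈ Finset.Nat.antidiagonalTuple l.length m,
        mzv (List.ofFn fun i => l.get i + c i) = (S l m).toReal := by
    have hlm : S l m ≠ ∞ := fun ht => by
      have := ENNReal.ne_top_of_tsum_ne_top hl m
      simp [ht, ENNReal.mul_top] at this
    simp_rw [mzv_eq_toReal]
    exact (ENNReal.toReal_sum fun c hc => ENNReal.sum_ne_top.1 hlm c hc).symm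
  rw [hreal k hfin, hreal _ (by rwa [← hgen _ (by norm_num) (by norm_num)]),
    eq_of_forall_tsum_pow_mul_eq hfin fun x hx hx' => hgen x hx.le (by linarith)]
end
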